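/- arXiv:2207.12526 — 7 statements merged into one kernel-verified Lean document; each statement's English description precedes it below -/
import Mathlib

section
/- Let G be an oriented graph and let H be an irreflexive oriented graph (no loops, and for any two distinct vertices at most one of the two possible arcs between them). Then a homomorphism f of G to H is ios-injective if and only if it is iot-injective. -/
/-- `f` is a homomorphism from the digraph with arc relation `A` to the digraph
with arc relation `B`. -/
def IsHom {V W : Type*} (A : V → V → Prop) (B : W → W → Prop) (f : V → W) : Prop :=
  ∀ ⦃x y : V⦄, A x y → B (f x) (f y)

/-- `f` is injective on the in-neighbourhood and on the out-neighbourhood of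
every vertex (separately). -/
def IosInj {V W : Type*} (A : V → V → Prop) (f : V → W) : Prop :=
  ∀ x : V, Set.InjOn f {y | A y x} ∧ Set.InjOn f {y | A x y}

/-- `f` is injective on the union of the in- and out-neighbourhood of every vertex. -/
def IotInj {V W : Type*} (A : V → V → Prop) (f : V → W) : Prop :=
  ∀ x : V, Set.InjOn f ({y | A y x} ∪ {y | A x y})

/-- For a homomorphism to an irreflexive oriented graph, ios-injectivity and
iot-injectivity coincide. -/
theorem ios_iff_iot_of_irreflexive {VG VH : Type*}
    (AG : VG → VG → Prop) (AH : VH → VH → Prop)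
    (hG : ∀ x y : VG, x ≠ y → ¬ (AG x y ∧ AG y x))
    (hHloop : ∀ x : VH, ¬ AH x x)
    (hHor : ∀ x y : VH, x ≠ y → ¬ (AH x y ∧ AH y x))
    (f : VG → VH) (hhom : IsHom AG AH f) :
    IosInj AG f ↔ IotInj AG f := by
  have no_mixed : ∀ {x y z : VG}, AG y x → AG x z → f y ≠ f z := by
    intro x y z hyx hxz h
    have hfxy : AH (f x) (f y) := h ▸ hhom hxz
    by_cases hne : f x = f y
    · exact hHloop (f y) (hne ▸ hfxy)
    · exact hHor _ _ hne ⟨hfxy, hhom hyx⟩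
  constructor
  · rintro h x y (hy | hy) z (hz | hz) hyz
    · exact (h x).1 hy hz hyz
    · exact absurd hyz (no_mixed hy hz)
    · exact absurd hyz.symm (no_mixed hz hy)
    · exact (h x).2 hy hz hyz
  · exact fun h x => ⟨(h x).mono Set.subset_union_left, (h x).mono Set.subset_union_right⟩
end

section
/- For d ≥ 1, let D_d be the oriented graph obtained from the directed cycle v₁, v₂, …, v₆d, v₁ by adding vertices x₁, x₂, …, x₃d and the arcs v₂ₜxₜ and xₜv₂ₜ₋₁ for t = 1, 2, …, 3d. In any ios-injective homomorphism of D_d to C₃ʳ, the vertices x₁, x₄, …, x₃d₋₂ all have the same image. -/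
/-- $C_3^r$: the directed 3-cycle with a loop added at every vertex. -/
def C3rArc (i j : Fin 3) : Prop := j = i ∨ j = i + 1

/-- The oriented graph \$D_d\$: the directed cycle \$v_1, \\dots, v_{6d}, v_1\$
(here `Sum.inl i` is \$v_{i+1}\$) together with vertices \$x_1, \\dots, x_{3d}\$
(here `Sum.inr t` is \$x_{t+1}\$) and arcs \$v_{2t}x_t\$ and \$x_tv_{2t-1}\$ for
\$t = 1, \\dots, 3d\$. -/
def DdArc (d : ℕ) : (Fin (6*d) ⊕ Fin (3*d)) → (Fin (6*d) ⊕ Fin (3*d)) → Prop :=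
  fun a b =>
    match a, b with
    | .inl i, .inl j => (j : ℕ) = ((i : ℕ) + 1) % (6*d)
    | .inl i, .inr t => (i : ℕ) = 2*(t : ℕ) + 1
    | .inr t, .inl i => (i : ℕ) = 2*(t : ℕ)
    | .inr _, .inr _ => False

/-- Two consecutive triangles `a, b, x` and `a', b', x'` of `D_d`, joined by the arc `b a'`:
the apex advances by one. -/
theorem C3rArc_apex_eq_add_one : ∀ a b x a' b' x' : Fin 3,
    (b = a ∨ b = a + 1) → (x = b ∨ x = b + 1) → (a = x ∨ a = x + 1) →
    (a' = b ∨ a' = b + 1) → (b' = a' ∨ b' = a' + 1) → (x' = b' ∨ x' = b' + 1) →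
    (a' = x' ∨ a' = x' + 1) → x ≠ a' → b ≠ x' → x' = x + 1 := by
  decide +kernel

theorem Dd_apex_succ (d : ℕ) (f : (Fin (6*d) ⊕ Fin (3*d)) → Fin 3)
    (hhom : IsHom (DdArc d) C3rArc f) (hinj : IosInj (DdArc d) f)
    (t : ℕ) (ht : t + 1 < 3*d) :
    f (Sum.inr ⟨t + 1, ht⟩) = f (Sum.inr ⟨t, by omega⟩) + 1 := by
  have cyc : ∀ (i : ℕ) (hi : i + 1 < 6*d),
      DdArc d (.inl ⟨i, by omega⟩) (.inl ⟨i + 1, hi⟩) := fun i hi =>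
    (Nat.mod_eq_of_lt hi).symm
  have into : ∀ (u : ℕ) (hu : u < 3*d),
      DdArc d (.inl ⟨2*u + 1, by omega⟩) (.inr ⟨u, hu⟩) := fun u hu => rfl
  have out : ∀ (u : ℕ) (hu : u < 3*d),
      DdArc d (.inr ⟨u, hu⟩) (.inl ⟨2*u, by omega⟩) := fun u hu => rfl
  have link : DdArc d (.inl ⟨2*t + 1, by omega⟩) (.inl ⟨2*(t + 1), by omega⟩) :=
    cyc (2*t + 1) (by omega)
  refine C3rArc_apex_eq_add_one _ _ _ _ _ _
    (hhom (cyc (2*t) (by omega))) (hhom (into t (by omega))) (hhom (out t (by omega)))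
    (hhom link) (hhom (cyc (2*(t + 1)) (by omega))) (hhom (into (t + 1) ht))
    (hhom (out (t + 1) ht)) (fun h => ?_) (fun h => ?_)
  · exact Sum.inr_ne_inl ((hinj (.inl ⟨2*t + 1, by omega⟩)).2 (into t (by omega)) link h)
  · exact Sum.inl_ne_inr ((hinj (.inl ⟨2*(t + 1), by omega⟩)).1 link (out (t + 1) ht) h)

theorem Dd_apex_three_mul (d : ℕ) (f : (Fin (6*d) ⊕ Fin (3*d)) → Fin 3)
    (hhom : IsHom (DdArc d) C3rArc f) (hinj : IosInj (DdArc d) f)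
    (s : ℕ) (hs : s < d) :
    f (Sum.inr ⟨3*s, by omega⟩) = f (Sum.inr ⟨0, by omega⟩) := by
  induction s with
  | zero => rfl
  | succ s ih =>
    have period : ∀ a : Fin 3, a + 1 + 1 + 1 = a := by decide
    rw [← ih (by omega), ← period (f (Sum.inr ⟨3*s, by omega⟩)),
      ← Dd_apex_succ d f hhom hinj (3*s) (by omega),
      ← Dd_apex_succ d f hhom hinj (3*s + 1) (by omega),
      ← Dd_apex_succ d f hhom hinj (3*s + 1 + 1) (by omega)]
    rfl

/-- In any ios-injective homomorphism of $D_d$ to $C_3^r$, the vertices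
$x_1, x_4, \dots, x_{3d-2}$ all have the same image. -/
theorem Dd_ios_to_C3r_same_image (d : ℕ) (hd : 1 ≤ d)
    (f : (Fin (6*d) ⊕ Fin (3*d)) → Fin 3)
    (hhom : IsHom (DdArc d) C3rArc f) (hinj : IosInj (DdArc d) f) :
    ∀ (s t : ℕ) (hs : s < d) (ht : t < d),
      f (Sum.inr ⟨3*s, by omega⟩) = f (Sum.inr ⟨3*t, by omega⟩) := by
  intro s t hs ht
  rw [Dd_apex_three_mul d f hhom hinj s hs, Dd_apex_three_mul d f hhom hinj t ht]
end

section
/- For t ≥ 1, let B₆ₜ be the oriented graph with vertices v₀, v₁, …, v₆ₜ₋₁ and arc set {v₀v₁, v₂v₃, …, v₆ₜ₋₂v₆ₜ₋₁} ∪ {v₀v₆ₜ₋₁, v₂v₁, v₄v₃, …, v₆ₜ₋₂v₆ₜ₋₃}. In any iot-injective homomorphism f of B₆ₜ to C₃ʳ, we have f(vᵢ) = f(vⱼ) whenever i ≡ j (mod 6). -/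
/-- The oriented cycle $B$ on vertices $v_0, \dots, v_{2k-1}$ consisting of two
disjoint perfect matchings oriented in opposite directions: arcs
$v_{2i}v_{2i+1}$ for $0 \le i \le k-1$ and $v_{2i}v_{2i-1 \bmod 2k}$ for
$0 \le i \le k-1$. -/
def BArc (k : ℕ) (a b : Fin (2*k)) : Prop :=
  (a : ℕ) % 2 = 0 ∧
    ((b : ℕ) = ((a : ℕ) + 1) % (2*k) ∨ (b : ℕ) = ((a : ℕ) + 2*k - 1) % (2*k))

theorem BArc.succ {k n : ℕ} (hn : n + 1 < 2 * k) (he : n % 2 = 0) :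
    BArc k ⟨n, by omega⟩ ⟨n + 1, hn⟩ :=
  ⟨he, Or.inl (Nat.mod_eq_of_lt hn).symm⟩

theorem BArc.pred {k n : ℕ} (hn : n + 1 < 2 * k) (ho : n % 2 = 1) :
    BArc k ⟨n + 1, hn⟩ ⟨n, by omega⟩ := by
  refine ⟨by simp only; omega, Or.inr ?_⟩
  simp only
  rw [show n + 1 + 2 * k - 1 = n + 2 * k by omega, Nat.add_mod_right,
    Nat.mod_eq_of_lt (by omega)]

/-- The two out-neighbours of a vertex mapped to `b` are mapped to `b` and `b + 1`. -/
theorem C3rArc.eq_of_out {a b c : Fin 3} (h₁ : C3rArc b a) (h₂ : C3rArc b c) (hne : a ≠ c) :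
    c = 2 * b + 1 - a := by
  unfold C3rArc at h₁ h₂
  revert a b c
  decide

/-- The two in-neighbours of a vertex mapped to `b` are mapped to `b` and `b - 1`. -/
theorem C3rArc.eq_of_in {a b c : Fin 3} (h₁ : C3rArc a b) (h₂ : C3rArc c b) (hne : a ≠ c) :
    c = 2 * b - 1 - a := by
  unfold C3rArc at h₁ h₂
  revert a b c
  decide

section Recurrence

variable {k : ℕ} {f : Fin (2 * k) → Fin 3}

theorem apply_add_two_of_odd (hhom : IsHom (BArc k) C3rArc f) (hinj : IotInj (BArc k) f)
    {n : ℕ} (hn : n + 2 < 2 * k) (ho : n % 2 = 1) :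
    f ⟨n + 2, hn⟩ = 2 * f ⟨n + 1, by omega⟩ + 1 - f ⟨n, by omega⟩ := by
  have h₁ := BArc.pred (k := k) (n := n) (by omega) ho
  have h₂ := BArc.succ (k := k) (n := n + 1) hn (by omega)
  refine C3rArc.eq_of_out (hhom h₁) (hhom h₂) fun h => ?_
  have := congrArg Fin.val (hinj _ (Or.inr h₁) (Or.inr h₂) h)
  simp only at this
  omega

theorem apply_add_two_of_even (hhom : IsHom (BArc k) C3rArc f) (hinj : IotInj (BArc k) f)
    {n : ℕ} (hn : n + 2 < 2 * k) (he : n % 2 = 0) :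
    f ⟨n + 2, hn⟩ = 2 * f ⟨n + 1, by omega⟩ - 1 - f ⟨n, by omega⟩ := by
  have h₁ := BArc.succ (k := k) (n := n) (by omega) he
  have h₂ := BArc.pred (k := k) (n := n + 1) hn (by omega)
  refine C3rArc.eq_of_in (hhom h₁) (hhom h₂) fun h => ?_
  have := congrArg Fin.val (hinj _ (Or.inl h₁) (Or.inl h₂) h)
  simp only at this
  omega

theorem apply_add_six (hhom : IsHom (BArc k) C3rArc f) (hinj : IotInj (BArc k) f)
    {n : ℕ} (hn : n + 6 < 2 * k) : f ⟨n + 6, hn⟩ = f ⟨n, by omega⟩ := by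
  rcases Nat.mod_two_eq_zero_or_one n with h | h
  · rw [apply_add_two_of_even hhom hinj (n := n + 4) hn (by omega),
      apply_add_two_of_odd hhom hinj (n := n + 3) (by omega) (by omega),
      apply_add_two_of_even hhom hinj (n := n + 2) (by omega) (by omega),
      apply_add_two_of_odd hhom hinj (n := n + 1) (by omega) (by omega),
      apply_add_two_of_even hhom hinj (n := n) (by omega) h]
    generalize f ⟨n, _⟩ = a
    generalize f ⟨n + 1, _⟩ = b
    revert a b
    decide
  · rw [apply_add_two_of_odd hhom hinj (n := n + 4) hn (by omega),
      apply_add_two_of_even hhom hinj (n := n + 3) (by omega) (by omega),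
      apply_add_two_of_odd hhom hinj (n := n + 2) (by omega) (by omega),
      apply_add_two_of_even hhom hinj (n := n + 1) (by omega) (by omega),
      apply_add_two_of_odd hhom hinj (n := n) (by omega) h]
    generalize f ⟨n, _⟩ = a
    generalize f ⟨n + 1, _⟩ = b
    revert a b
    decide

theorem apply_add_six_mul (hhom : IsHom (BArc k) C3rArc f) (hinj : IotInj (BArc k) f)
    (n m : ℕ) (hn : n + 6 * m < 2 * k) : f ⟨n + 6 * m, hn⟩ = f ⟨n, by omega⟩ := by
  induction m with
  | zero => rfl
  | succ m ih =>
    exact (apply_add_six hhom hinj (n := n + 6 * m) (by omega)).trans (ih (by omega))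

theorem apply_eq_apply_mod_six (hhom : IsHom (BArc k) C3rArc f) (hinj : IotInj (BArc k) f)
    (i : Fin (2 * k)) : f i = f ⟨i % 6, (Nat.mod_le _ _).trans_lt i.isLt⟩ := by
  rw [← apply_add_six_mul hhom hinj (i % 6) (i / 6) (by omega)]
  congr 1
  ext
  exact (Nat.mod_add_div _ _).symm

end Recurrence

/-- In any iot-injective homomorphism $f$ of $B_{6t}$ to $C_3^r$ we have
$f(v_i) = f(v_j)$ whenever $i \equiv j \pmod 6$. -/
theorem B6t_iot_to_C3r_periodic (t : ℕ) (ht : 1 ≤ t)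
    (f : Fin (2*(3*t)) → Fin 3)
    (hhom : IsHom (BArc (3*t)) C3rArc f) (hinj : IotInj (BArc (3*t)) f) :
    ∀ i j : Fin (2*(3*t)), (i : ℕ) % 6 = (j : ℕ) % 6 → f i = f j := by
  intro i j hij
  rw [apply_eq_apply_mod_six hhom hinj i, apply_eq_apply_mod_six hhom hinj j]
  congr 1
  ext
  exact hij
end

section
/- For each m ≥ 4, any two distinct vertices of the tournament U_m have a common in-neighbour or a common out-neighbour. Here U_m is the tournament on m vertices consisting of a directed 3-cycle together with a transitive tournament on m − 3 vertices, where every vertex of the transitive part has an arc to each of the three vertices of the 3-cycle. -/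
/-- The tournament $U_m$ on $m$ vertices: vertices $0, 1, 2$ form a directed
3-cycle, vertices $3, \dots, m-1$ form a transitive tournament, and every
vertex of the transitive part has an arc to each vertex of the 3-cycle. -/
def UArc (m : ℕ) (a b : Fin m) : Prop :=
  ((a : ℕ) < 3 ∧ (b : ℕ) < 3 ∧ (b : ℕ) = ((a : ℕ) + 1) % 3) ∨
    (3 ≤ (a : ℕ) ∧ ((b : ℕ) < 3 ∨ (a : ℕ) < (b : ℕ)))

/-- Any two distinct vertices of $U_m$ ($m \ge 4$) have a common in-neighbour or
a common out-neighbour. -/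
theorem Um_common_neighbour (m : ℕ) (hm : 4 ≤ m) :
    ∀ u v : Fin m, u ≠ v →
      (∃ w : Fin m, UArc m w u ∧ UArc m w v) ∨
      (∃ w : Fin m, UArc m u w ∧ UArc m v w) := by
  intro u v _
  rcases lt_or_ge (u : ℕ) 3 with hu | hu
  · rcases lt_or_ge (v : ℕ) 3 with hv | hv
    · exact Or.inl ⟨⟨3, by omega⟩, Or.inr ⟨le_rfl, Or.inl hu⟩, Or.inr ⟨le_rfl, Or.inl hv⟩⟩
    · have h : ((u : ℕ) + 1) % 3 < 3 := Nat.mod_lt _ (by norm_num)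
      exact Or.inr ⟨⟨((u : ℕ) + 1) % 3, by omega⟩, Or.inl ⟨hu, h, rfl⟩, Or.inr ⟨hv, Or.inl h⟩⟩
  · have h : ((v : ℕ) + 1) % 3 < 3 := Nat.mod_lt _ (by norm_num)
    refine Or.inr ⟨⟨((v : ℕ) + 1) % 3, by omega⟩, Or.inr ⟨hu, Or.inl h⟩, ?_⟩
    rcases lt_or_ge (v : ℕ) 3 with hv | hv
    · exact Or.inl ⟨hv, h, rfl⟩
    · exact Or.inr ⟨hv, Or.inl h⟩
end

section
/- For each m ≥ 4, every ios-injective homomorphism of the tournament U_m to any directed graph H is injective. Consequently, if an oriented graph G contains U_m as a subgraph and G has an ios-injective homomorphism to a tournament T (respectively, a reflexive tournament Tʳ), then T contains U_m (respectively, Tʳ contains the reflexive tournament U_mʳ) as a subgraph. -/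
/-- In `UArc m` any two vertices have a common in-neighbour or a common out-neighbour. -/
theorem UArc.exists_common_neighbour {m : ℕ} (hm : 4 ≤ m) (a b : Fin m) :
    (∃ x, UArc m x a ∧ UArc m x b) ∨ ∃ x, UArc m a x ∧ UArc m b x := by
  unfold UArc
  by_cases ha : (a : ℕ) < 3 <;> by_cases hb : (b : ℕ) < 3
  · exact Or.inl ⟨⟨3, by omega⟩, by simp only; omega, by simp only; omega⟩
  · exact Or.inr ⟨⟨((a : ℕ) + 1) % 3, by omega⟩, Or.inl ⟨ha, Nat.mod_lt _ (by omega), rfl⟩,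
      Or.inr ⟨by omega, Or.inl (Nat.mod_lt _ (by omega))⟩⟩
  · exact Or.inr ⟨⟨((b : ℕ) + 1) % 3, by omega⟩, Or.inr ⟨by omega, Or.inl (Nat.mod_lt _ (by omega))⟩,
      Or.inl ⟨hb, Nat.mod_lt _ (by omega), rfl⟩⟩
  · exact Or.inr ⟨⟨0, by omega⟩, by simp only; omega, by simp only; omega⟩

/-- A map that is ios-injective on a digraph is injective on every copy of `UArc m` in it. -/
theorem IosInj.injective_comp_of_UArc {V W : Type*} {A : V → V → Prop} {f : V → W}
    (hf : IosInj A f) {m : ℕ} (hm : 4 ≤ m) {g : Fin m → V} (hg : Function.Injective g)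
    (hom : IsHom (UArc m) A g) : Function.Injective (f ∘ g) := by
  intro a b h
  by_contra hab
  obtain ⟨x, hxa, hxb⟩ | ⟨x, hax, hbx⟩ := UArc.exists_common_neighbour hm a b
  · exact hab (hg ((hf (g x)).2 (hom hxa) (hom hxb) h))
  · exact hab (hg ((hf (g x)).1 (hom hax) (hom hbx) h))

/-- Every ios-injective homomorphism of $U_m$ ($m \ge 4$) to any directed graph is
injective; consequently, if an oriented graph $G$ contains $U_m$ as a subgraph
and $G$ has an ios-injective homomorphism to a tournament $T$ (respectively, a
reflexive tournament $T^r$), then $T$ contains $U_m$ (respectively, $T^r$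
contains $U_m^r$) as a subgraph. -/
theorem Um_ios_injective (m : ℕ) (hm : 4 ≤ m) :
    (∀ (W : Type) (B : W → W → Prop) (f : Fin m → W),
        IsHom (UArc m) B f → IosInj (UArc m) f → Function.Injective f) ∧
    (∀ (V : Type) (A : V → V → Prop) (g : Fin m → V),
        Function.Injective g → (∀ a b : Fin m, UArc m a b → A (g a) (g b)) →
        ∀ (VT : Type) (T : VT → VT → Prop),
          (∀ x : VT, ¬ T x x) → (∀ x y : VT, x ≠ y → (T x y ↔ ¬ T y x)) →
          ∀ f : V → VT, IsHom A T f → IosInj A f →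
            ∃ h : Fin m → VT, Function.Injective h ∧
              ∀ a b : Fin m, UArc m a b → T (h a) (h b)) ∧
    (∀ (V : Type) (A : V → V → Prop) (g : Fin m → V),
        Function.Injective g → (∀ a b : Fin m, UArc m a b → A (g a) (g b)) →
        ∀ (VT : Type) (T : VT → VT → Prop),
          (∀ x : VT, T x x) → (∀ x y : VT, x ≠ y → (T x y ↔ ¬ T y x)) →
          ∀ f : V → VT, IsHom A T f → IosInj A f →
            ∃ h : Fin m → VT, Function.Injective h ∧
              ∀ a b : Fin m, a = b ∨ UArc m a b → T (h a) (h b)) := by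
  refine ⟨?_, ?_, ?_⟩
  · intro W B f _ hf
    exact hf.injective_comp_of_UArc hm (g := id) Function.injective_id fun _ _ h => h
  · intro V A g hg hom VT T _ _ f hfT hf
    exact ⟨f ∘ g, hf.injective_comp_of_UArc hm hg hom, fun a b h => hfT (hom a b h)⟩
  · intro V A g hg hom VT T hrefl _ f hfT hf
    refine ⟨f ∘ g, hf.injective_comp_of_UArc hm hg hom, ?_⟩
    rintro a b (rfl | h)
    · exact hrefl _
    · exact hfT (hom a b h)
end

section
/- Let G be a cubic graph (a finite simple undirected graph in which every vertex has degree 3), and let G′ be the oriented graph obtained from G as follows: the vertices of G′ are the vertices of G together with, for each edge xy of G, four new vertices v₁^{xy}, v₂^{xy}, v₃^{xy}, v₄^{xy}; the arcs of G′ are, for each edge xy of G, the arcs x v₁^{xy}, v₁^{xy} v₂^{xy}, v₂^{xy} v₃^{xy}, v₃^{xy} v₄^{xy}, and y v₄^{xy}. Then G is 3-edge-colourable (its edges can be properly coloured with 3 colours so that edges sharing an endpoint get different colours) if and only if G′ has an ios-injective homomorphism to U₄. -/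
/-- The oriented graph $G'$ built from an orientation `E` of the edges of a
graph on `V`: each oriented edge $(x, y) \in E$ is replaced by the oriented path
with new vertices $v_1, v_2, v_3, v_4$ (here `Sum.inr (x, y, i)` is $v_{i+1}$)
and arcs $x v_1$, $v_1 v_2$, $v_2 v_3$, $v_3 v_4$, $y v_4$. -/
def PathReplArc {V : Type} (E : Set (V × V)) :
    (V ⊕ (V × V × Fin 4)) → (V ⊕ (V × V × Fin 4)) → Prop :=
  fun p q =>
    match p, q with
    | .inl x, .inr (a, b, i) => (a, b) ∈ E ∧ ((x = a ∧ i = 0) ∨ (x = b ∧ i = 3))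
    | .inr (a, b, i), .inr (a', b', j) =>
        (a, b) ∈ E ∧ a = a' ∧ b = b' ∧ (j : ℕ) = (i : ℕ) + 1
    | _, _ => False

/-- A vertex of `U₄` with two distinct out-neighbours is the source vertex. -/
theorem UArc.eq_three_of_ne {a b c : Fin 4} (hb : UArc 4 a b) (hc : UArc 4 a c) (hbc : b ≠ c) :
    a = 3 := by
  simp only [UArc] at hb hc
  omega

/-- A directed walk with three arcs in `U₄` that starts in the 3-cycle is closed. -/
theorem UArc.eq_of_walk {a b c d : Fin 4} (ha : (a : ℕ) < 3) (hab : UArc 4 a b)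
    (hbc : UArc 4 b c) (hcd : UArc 4 c d) : d = a := by
  simp only [UArc] at hab hbc hcd
  omega

theorem UArc.lt_three_of_source {b : Fin 4} (h : UArc 4 3 b) : (b : ℕ) < 3 := by
  simp only [UArc] at h
  omega

/-- In an ios-injective homomorphism to `U₄`, a vertex with two out-neighbours is sent to the
source vertex. -/
theorem IsHom.eq_three_of_ne {V : Type*} {A : V → V → Prop} {f : V → Fin 4}
    (hf : IsHom A (UArc 4) f) (hi : IosInj A f) {x y z : V} (hy : A x y) (hz : A x z)
    (hyz : y ≠ z) : f x = 3 :=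
  UArc.eq_three_of_ne (hf hy) (hf hz) fun h => hyz ((hi x).2 hy hz h)

/-- The map to `U₄` determined by a 3-colouring `c` of the edges: original vertices go to the
source, and the path replacing an edge `e` winds once around the 3-cycle starting at `c e`. -/
def windingMap {V : Type} (c : V × V → Fin 3) : V ⊕ (V × V × Fin 4) → Fin 4
  | .inl _ => 3
  | .inr (a, b, i) => ⟨((c (a, b) : ℕ) + i) % 3, by omega⟩

theorem isHom_windingMap {V : Type} (E : Set (V × V)) (c : V × V → Fin 3) :
    IsHom (PathReplArc E) (UArc 4) (windingMap c) := by
  rintro (x | ⟨a, b, i⟩) (y | ⟨a', b', j⟩) h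
  · exact h.elim
  · simp only [UArc, windingMap]
    omega
  · exact h.elim
  · obtain ⟨-, rfl, rfl, hj⟩ := h
    simp only [UArc, windingMap]
    omega

theorem iosInj_windingMap {V : Type} {E : Set (V × V)} (hE : ∀ x y : V, (x, y) ∈ E → (y, x) ∉ E)
    {c : V × V → Fin 3}
    (hc : ∀ p ∈ E, ∀ q ∈ E, p ≠ q →
      (p.1 = q.1 ∨ p.1 = q.2 ∨ p.2 = q.1 ∨ p.2 = q.2) → c p ≠ c q) :
    IosInj (PathReplArc E) (windingMap c) := by
  intro v
  constructor
  · rintro (x | ⟨a, b, i⟩) hx (y | ⟨a', b', j⟩) hy hxy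
    · obtain _ | ⟨a, b, i⟩ := v
      · exact hx.elim
      · obtain ⟨-, ⟨rfl, rfl⟩ | ⟨rfl, rfl⟩⟩ := hx <;> obtain ⟨-, ⟨rfl, h⟩ | ⟨rfl, h⟩⟩ := hy <;>
          first | rfl | simp at h
    · simp only [windingMap, Fin.ext_iff, Fin.isValue] at hxy
      omega
    · simp only [windingMap, Fin.ext_iff, Fin.isValue] at hxy
      omega
    · obtain _ | ⟨a'', b'', k⟩ := v
      · exact hx.elim
      · obtain ⟨-, rfl, rfl, hi⟩ := hx
        obtain ⟨-, rfl, rfl, hj⟩ := hy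
        obtain rfl : i = j := by omega
        rfl
  · rintro (x | ⟨a, b, i⟩) hx (y | ⟨a', b', j⟩) hy hxy
    · cases v <;> exact hx.elim
    · cases v <;> exact hx.elim
    · cases v <;> exact hy.elim
    · obtain v | ⟨a'', b'', k⟩ := v
      · obtain ⟨hab, hi⟩ := hx
        obtain ⟨hab', hj⟩ := hy
        have hcol : c (a, b) = c (a', b') := by
          have hi' : (i : ℕ) % 3 = 0 := by obtain ⟨-, rfl⟩ | ⟨-, rfl⟩ := hi <;> rfl
          have hj' : (j : ℕ) % 3 = 0 := by obtain ⟨-, rfl⟩ | ⟨-, rfl⟩ := hj <;> rfl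
          simp only [windingMap, Fin.mk.injEq] at hxy
          omega
        have hedge : (a, b) = (a', b') := by
          by_contra hne
          refine hc _ hab _ hab' hne ?_ hcol
          obtain ⟨rfl, -⟩ | ⟨rfl, -⟩ := hi <;> obtain ⟨rfl, -⟩ | ⟨rfl, -⟩ := hj <;> simp
        obtain ⟨rfl, rfl⟩ := Prod.mk.inj hedge
        have hne : a ≠ b := by
          rintro rfl
          exact hE _ _ hab hab
        obtain ⟨rfl, rfl⟩ | ⟨rfl, rfl⟩ := hi <;> obtain ⟨h, rfl⟩ | ⟨h, rfl⟩ := hj <;>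
          first | rfl | exact absurd h hne | exact absurd h.symm hne
      · obtain ⟨-, rfl, rfl, hi⟩ := hx
        obtain ⟨-, rfl, rfl, hj⟩ := hy
        obtain rfl : i = j := by omega
        rfl

/-- An ios-injective homomorphism to `U₄` sending all original vertices to the source colours the
edges properly, by the colour of the first inner vertex of the path replacing an edge. -/
theorem exists_edge_colouring_of_source {V : Type} {E : Set (V × V)}
    {f : V ⊕ (V × V × Fin 4) → Fin 4} (hf : IsHom (PathReplArc E) (UArc 4) f)
    (hi : IosInj (PathReplArc E) f) (hsrc : ∀ x : V, f (.inl x) = 3) :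
    ∃ c : V × V → Fin 3, ∀ p ∈ E, ∀ q ∈ E, p ≠ q →
      (p.1 = q.1 ∨ p.1 = q.2 ∨ p.2 = q.1 ∨ p.2 = q.2) → c p ≠ c q := by
  have harc₀ : ∀ {a b}, (a, b) ∈ E → PathReplArc E (.inl a) (.inr (a, b, 0)) :=
    fun h => ⟨h, .inl ⟨rfl, rfl⟩⟩
  have harc₃ : ∀ {a b}, (a, b) ∈ E → PathReplArc E (.inl b) (.inr (a, b, 3)) :=
    fun h => ⟨h, .inr ⟨rfl, rfl⟩⟩
  have hlt : ∀ {a b}, (a, b) ∈ E → (f (.inr (a, b, 0)) : ℕ) < 3 := fun {a b} h =>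
    UArc.lt_three_of_source (hsrc a ▸ hf (harc₀ h))
  have hends : ∀ {a b}, (a, b) ∈ E → f (.inr (a, b, 3)) = f (.inr (a, b, 0)) := fun {a b} h =>
    have hstep : ∀ i j : Fin 4, (j : ℕ) = i + 1 →
        UArc 4 (f (.inr (a, b, i))) (f (.inr (a, b, j))) := fun i j hij =>
      hf (show PathReplArc E (.inr (a, b, i)) (.inr (a, b, j)) from ⟨h, rfl, rfl, hij⟩)
    UArc.eq_of_walk (hlt h) (hstep 0 1 rfl) (hstep 1 2 rfl) (hstep 2 3 rfl)
  refine ⟨fun p => Fin.ofNat 3 (f (.inr (p.1, p.2, 0))), ?_⟩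
  rintro ⟨a, b⟩ hp ⟨a', b'⟩ hq hne hshare hcol
  have hcol' : f (.inr (a, b, 0)) = f (.inr (a', b', 0)) := by
    have h₁ := hlt hp
    have h₂ := hlt hq
    simpa [Fin.ext_iff, Nat.mod_eq_of_lt h₁, Nat.mod_eq_of_lt h₂] using hcol
  have key : ∀ {x : V} {i j : Fin 4}, PathReplArc E (.inl x) (.inr (a, b, i)) →
      PathReplArc E (.inl x) (.inr (a', b', j)) →
      f (.inr (a, b, i)) = f (.inr (a', b', j)) → False := by
    intro x i j h₁ h₂ h
    have := (hi (.inl x)).2 h₁ h₂ h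
    simp only [Sum.inr.injEq, Prod.mk.injEq] at this
    exact hne (Prod.ext this.1 this.2.1)
  dsimp only at hshare
  obtain rfl | rfl | rfl | rfl := hshare
  · exact key (harc₀ hp) (harc₀ hq) hcol'
  · exact key (harc₀ hp) (harc₃ hq) (hcol'.trans (hends hq).symm)
  · exact key (harc₃ hp) (harc₀ hq) ((hends hp).trans hcol')
  · exact key (harc₃ hp) (harc₃ hq) ((hends hp).trans (hcol'.trans (hends hq).symm))

/-- A cubic graph $G$ is 3-edge-colourable iff the oriented graph $G'$, obtained
by replacing each edge $xy$ of $G$ by the oriented path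
$x \to v_1 \to v_2 \to v_3 \to v_4 \leftarrow y$, has an ios-injective
homomorphism to $U_4$.  The set `E` records an arbitrary orientation of the
edges of $G$, each edge occurring exactly once. -/
theorem cubic_three_edge_colourable_iff (V : Type) [Fintype V] [DecidableEq V]
    (G : SimpleGraph V) [DecidableRel G.Adj]
    (hcubic : ∀ v : V, G.degree v = 3)
    (E : Set (V × V))
    (hE1 : ∀ x y : V, G.Adj x y ↔ ((x, y) ∈ E ∨ (y, x) ∈ E))
    (hE2 : ∀ x y : V, (x, y) ∈ E → (y, x) ∉ E) :
    (∃ c : V × V → Fin 3, ∀ p ∈ E, ∀ q ∈ E, p ≠ q →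
        (p.1 = q.1 ∨ p.1 = q.2 ∨ p.2 = q.1 ∨ p.2 = q.2) → c p ≠ c q) ↔
    (∃ f : (V ⊕ (V × V × Fin 4)) → Fin 4,
        IsHom (PathReplArc E) (UArc 4) f ∧ IosInj (PathReplArc E) f) := by
  constructor
  · rintro ⟨c, hc⟩
    exact ⟨windingMap c, isHom_windingMap E c, iosInj_windingMap hE2 hc⟩
  · rintro ⟨f, hf, hi⟩
    refine exists_edge_colouring_of_source hf hi fun x => ?_
    obtain ⟨y, hy, z, hz, hyz⟩ := Finset.one_lt_card.mp
      (show 1 < (G.neighborFinset x).card by rw [G.card_neighborFinset_eq_degree, hcubic]; simp)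
    rw [SimpleGraph.mem_neighborFinset] at hy hz
    have hout : ∀ {w}, G.Adj x w → ∃ v, PathReplArc E (.inl x) (.inr v) ∧
        (v = (x, w, 0) ∨ v = (w, x, 3)) := by
      intro w hw
      obtain h | h := (hE1 x w).mp hw
      · exact ⟨(x, w, 0), ⟨h, .inl ⟨rfl, rfl⟩⟩, .inl rfl⟩
      · exact ⟨(w, x, 3), ⟨h, .inr ⟨rfl, rfl⟩⟩, .inr rfl⟩
    obtain ⟨v, hv, hvy⟩ := hout hy
    obtain ⟨w, hw, hwz⟩ := hout hz
    refine hf.eq_three_of_ne hi hv hw fun h => hyz ?_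
    have hvw := Sum.inr.inj h
    obtain rfl | rfl := hvy <;> obtain rfl | rfl := hwz <;> simp_all
end

section
/- For every d ≥ 1, there is no ios-injective homomorphism of D_d to T₃ʳ, where D_d is the oriented graph obtained from the directed cycle v₁, v₂, …, v₆d, v₁ by adding vertices x₁, x₂, …, x₃d and the arcs v₂ₜxₜ and xₜv₂ₜ₋₁ for t = 1, 2, …, 3d. -/
/-- $T_3^r$: the reflexive transitive tournament on $t_0, t_1, t_2$ with arcs
$t_0t_1, t_0t_2, t_1t_2$ and a loop at every vertex. -/
def T3rArc (a b : Fin 3) : Prop := a ≤ b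

/-- For every $d \ge 1$ there is no ios-injective homomorphism of $D_d$ to
$T_3^r$. -/
theorem no_ios_Dd_to_T3r (d : ℕ) (hd : 1 ≤ d) :
    ¬ ∃ f : (Fin (6*d) ⊕ Fin (3*d)) → Fin 3,
        IsHom (DdArc d) T3rArc f ∧ IosInj (DdArc d) f := by
  rintro ⟨f, hom, inj⟩
  have step (i j : ℕ) (hi : i < 6*d) (hj : j < 6*d) (h : j = (i + 1) % (6*d)) :
      f (.inl ⟨i, hi⟩) ≤ f (.inl ⟨j, hj⟩) :=
    @hom (.inl ⟨i, hi⟩) (.inl ⟨j, hj⟩) h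
  have mono (n : ℕ) (hn : 2 ≤ n) :
      ∀ h : n < 6*d, f (.inl ⟨2, by omega⟩) ≤ f (.inl ⟨n, h⟩) := by
    induction n, hn using Nat.le_induction with
    | base => exact fun _ => le_rfl
    | succ n _ ih =>
      intro h
      exact (ih (by omega)).trans (step n (n + 1) _ h (Nat.mod_eq_of_lt h).symm)
  have h12 := step 1 2 (by omega) (by omega) (Nat.mod_eq_of_lt (by omega)).symm
  have h01 := step 0 1 (by omega) (by omega) (Nat.mod_eq_of_lt (by omega)).symm
  have hlast := mono (6*d - 1) (by omega) (by omega)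
  have hclose := step (6*d - 1) 0 (by omega) (by omega)
    (by rw [Nat.sub_add_cancel (by omega), Nat.mod_self])
  have h1x : f (.inl ⟨1, by omega⟩) ≤ f (.inr ⟨0, by omega⟩) :=
    @hom (.inl ⟨1, by omega⟩) (.inr ⟨0, by omega⟩) rfl
  have hx0 : f (.inr ⟨0, by omega⟩) ≤ f (.inl ⟨0, by omega⟩) :=
    @hom (.inr ⟨0, by omega⟩) (.inl ⟨0, by omega⟩) rfl
  have heq : f (.inr ⟨0, by omega⟩) = f (.inl ⟨2, by omega⟩) :=
    le_antisymm (hx0.trans (h01.trans h12)) (hlast.trans (hclose.trans (h01.trans h1x)))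
  have hmem : DdArc d (.inl ⟨1, by omega⟩) (.inl ⟨2, by omega⟩) :=
    (Nat.mod_eq_of_lt (show 1 + 1 < 6*d by omega)).symm
  exact Sum.inr_ne_inl ((inj (.inl ⟨1, by omega⟩)).2
    (show DdArc d (.inl ⟨1, by omega⟩) (.inr ⟨0, by omega⟩) from rfl) hmem heq)
end
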